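/- Let 0 < α < 2 with α ≠ 1. Then for every x ∈ ℝ with |x| ≠ 1, ∫_{−1}^{1} sgn(x−y) |x−y|^{α−1} (1−y²)^{−(α−1)/2} dy = (α−1) c_α x if |x| < 1, and = (α−1) c_α x + (α−1) c_α^{(1)} sgn(x)(|x|−1) − (α−1)(α−2) C_α sgn(x) ∫_{1}^{|x|} ∫_{y}^{∞} (z²−1)^{−(3−α)/2} dz dy if |x| > 1, where c_α = π / sin((α−1)π/2), C_α = √π Γ((3-α)/2)/Γ((4-α)/2), and (α−1) c_α^{(1)} = −2 C_α Γ((α+1)/2) Γ((4−α)/2)/√π. -/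

import Mathlib

open MeasureTheory Real

/-- The Beta integral over `(0, 1)` in real form. -/
theorem integrableOn_and_integral_rpow_mul_one_sub_rpow {p q : ℝ} (hp : -1 < p) (hq : -1 < q) :
    IntegrableOn (fun t : ℝ => t ^ p * (1 - t) ^ q) (Set.Ioo 0 1) ∧
      ∫ t in Set.Ioo (0 : ℝ) 1, t ^ p * (1 - t) ^ q =
        Gamma (p + 1) * Gamma (q + 1) / Gamma (p + q + 2) := by
  have hconv := Complex.betaIntegral_convergent (u := ((p + 1 : ℝ) : ℂ)) (v := ((q + 1 : ℝ) : ℂ))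
    (by rw [Complex.ofReal_re]; linarith) (by rw [Complex.ofReal_re]; linarith)
  rw [intervalIntegrable_iff_integrableOn_Ioo_of_le zero_le_one] at hconv
  have heq : Set.EqOn (fun t : ℝ => (t : ℂ) ^ (((p + 1 : ℝ) : ℂ) - 1) *
      (1 - (t : ℂ)) ^ (((q + 1 : ℝ) : ℂ) - 1)) (fun t : ℝ => ((t ^ p * (1 - t) ^ q : ℝ) : ℂ))
      (Set.Ioo 0 1) := by
    intro t ht
    simp only
    rw [Complex.ofReal_mul, Complex.ofReal_cpow ht.1.le, Complex.ofReal_cpow (by linarith [ht.2])]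
    push_cast
    simp only [add_sub_cancel_right]
  have hint := (hconv.congr_fun heq measurableSet_Ioo).re
  simp only [RCLike.re_to_complex, Complex.ofReal_re] at hint
  refine ⟨hint, ?_⟩
  have hb := ProbabilityTheory.beta_eq_betaIntegralReal (p + 1) (q + 1) (by linarith) (by linarith)
  rw [ProbabilityTheory.beta, Complex.betaIntegral, intervalIntegral.integral_of_le zero_le_one,
    integral_Ioc_eq_integral_Ioo, setIntegral_congr_fun measurableSet_Ioo heq,
    integral_complex_ofReal,
    Complex.ofReal_re] at hb
  rw [← hb]
  ring_nf

/-- The Beta integral over `(-1, 1)`. -/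
theorem integrableOn_and_integral_one_sub_rpow_mul_one_add_rpow {p q : ℝ}
    (hp : -1 < p) (hq : -1 < q) :
    IntegrableOn (fun y : ℝ => (1 - y) ^ p * (1 + y) ^ q) (Set.Ioo (-1) 1) ∧
      ∫ y in Set.Ioo (-1 : ℝ) 1, (1 - y) ^ p * (1 + y) ^ q =
        2 ^ (p + q + 1) * (Gamma (p + 1) * Gamma (q + 1) / Gamma (p + q + 2)) := by
  obtain ⟨hint, hval⟩ := integrableOn_and_integral_rpow_mul_one_sub_rpow hp hq
  have himg : (fun y : ℝ => (1 - y) / 2) '' Set.Ioo (-1) 1 = Set.Ioo 0 1 := by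
    ext t
    constructor
    · rintro ⟨y, hy, rfl⟩
      exact ⟨by linarith [hy.2], by linarith [hy.1]⟩
    · intro ht
      exact ⟨1 - 2 * t, ⟨by linarith [ht.2], by linarith [ht.1]⟩, by ring⟩
  have hderiv : ∀ y ∈ Set.Ioo (-1 : ℝ) 1,
      HasDerivWithinAt (fun y : ℝ => (1 - y) / 2) (-1 / 2) (Set.Ioo (-1) 1) y := fun y _ =>
    (((hasDerivAt_id y).const_sub 1).div_const 2).hasDerivWithinAt
  have hinj : Set.InjOn (fun y : ℝ => (1 - y) / 2) (Set.Ioo (-1) 1) := by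
    intro y _ z _ h
    simp only at h
    linarith
  have heq : Set.EqOn (fun y : ℝ => |(-1 / 2 : ℝ)| • (((1 - y) / 2) ^ p * (1 - (1 - y) / 2) ^ q))
      (fun y => (2 ^ (p + q + 1))⁻¹ * ((1 - y) ^ p * (1 + y) ^ q)) (Set.Ioo (-1) 1) := by
    intro y hy
    have h1 : 0 ≤ 1 - y := by linarith [hy.2]
    have h2 : 0 ≤ 1 + y := by linarith [hy.1]
    simp only [smul_eq_mul]
    rw [show 1 - (1 - y) / 2 = (1 + y) / 2 by ring, div_rpow h1 zero_le_two,
      div_rpow h2 zero_le_two, rpow_add two_pos, rpow_add two_pos, rpow_one,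
      abs_of_neg (by norm_num)]
    field_simp
  have h2 : (2 : ℝ) ^ (p + q + 1) ≠ 0 := (rpow_pos_of_pos two_pos _).ne'
  rw [← himg, integrableOn_image_iff_integrableOn_abs_deriv_smul measurableSet_Ioo hderiv hinj,
    integrableOn_congr_fun heq measurableSet_Ioo] at hint
  rw [← himg, integral_image_eq_integral_abs_deriv_smul measurableSet_Ioo hderiv hinj,
    setIntegral_congr_fun measurableSet_Ioo heq, integral_const_mul] at hval
  refine ⟨?_, ?_⟩
  · have := hint.const_mul (2 ^ (p + q + 1))
    simpa [IntegrableOn, mul_inv_cancel_left₀ h2] using this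
  · rw [← hval, mul_inv_cancel_left₀ h2]

theorem one_sub_sq_rpow {y : ℝ} (hy : y ∈ Set.Ioo (-1 : ℝ) 1) (b : ℝ) :
    (1 - y ^ 2) ^ b = (1 - y) ^ b * (1 + y) ^ b := by
  rw [← mul_rpow (by linarith [hy.2]) (by linarith [hy.1])]
  ring_nf

theorem integral_one_sub_sq_rpow {b : ℝ} (hb : -1 < b) :
    ∫ y in Set.Ioo (-1 : ℝ) 1, (1 - y ^ 2) ^ b = √π * Gamma (b + 1) / Gamma (b + 3 / 2) := by
  rw [setIntegral_congr_fun measurableSet_Ioo fun y hy => one_sub_sq_rpow hy b,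
    (integrableOn_and_integral_one_sub_rpow_mul_one_add_rpow hb hb).2]
  have h := Gamma_mul_Gamma_add_half (b + 1)
  have h2 : (2 : ℝ) ^ (1 - 2 * (b + 1)) * 2 ^ (b + b + 1) = 1 := by
    rw [← rpow_add two_pos]
    ring_nf
    simp
  have h3 : Gamma (b + 3 / 2) ≠ 0 := (Gamma_pos_of_pos (by linarith)).ne'
  have h4 : Gamma (b + b + 2) ≠ 0 := (Gamma_pos_of_pos (by linarith)).ne'
  rw [show b + 1 + 1 / 2 = b + 3 / 2 by ring, show 2 * (b + 1) = b + b + 2 by ring] at h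
  rw [show 2 * (b + 1) = b + b + 2 by ring] at h2
  rw [mul_div_assoc', div_eq_div_iff h4 h3]
  linear_combination (Gamma (b + 1) * 2 ^ (b + b + 1)) * h +
    (Gamma (b + 1) * Gamma (b + b + 2) * √π) * h2

theorem integrableOn_one_sub_sq_rpow {b : ℝ} (hb : -1 < b) :
    IntegrableOn (fun y : ℝ => (1 - y ^ 2) ^ b) (Set.Ioo (-1) 1) :=
  (integrableOn_and_integral_one_sub_rpow_mul_one_add_rpow hb hb).1.congr_fun
    (fun _ hy => (one_sub_sq_rpow hy b).symm) measurableSet_Ioo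

/-- Change of variables by the Möbius automorphism `s ↦ (s + r) / (1 + r s)` of `(-1, 1)`. -/
theorem integral_mobius {r : ℝ} (hr : r ∈ Set.Ioo (-1 : ℝ) 1) (g : ℝ → ℝ) :
    ∫ y in Set.Ioo (-1 : ℝ) 1, g y =
      ∫ s in Set.Ioo (-1 : ℝ) 1, (1 - r ^ 2) / (1 + r * s) ^ 2 * g ((s + r) / (1 + r * s)) := by
  obtain ⟨hr1, hr2⟩ := hr
  have hpos : ∀ s ∈ Set.Ioo (-1 : ℝ) 1, 0 < 1 + r * s := fun s hs => by
    nlinarith [hs.1, hs.2]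
  have himg : (fun s : ℝ => (s + r) / (1 + r * s)) '' Set.Ioo (-1) 1 = Set.Ioo (-1) 1 := by
    ext t
    constructor
    · rintro ⟨s, hs, rfl⟩
      have := hpos s hs
      exact ⟨by rw [lt_div_iff₀ this]; nlinarith [hs.1], by rw [div_lt_iff₀ this]; nlinarith [hs.2]⟩
    · intro ht
      have h1 : 0 < 1 - r * t := by nlinarith [ht.1, ht.2]
      refine ⟨(t - r) / (1 - r * t), ⟨?_, ?_⟩, ?_⟩
      · rw [lt_div_iff₀ h1]; nlinarith [ht.1]
      · rw [div_lt_iff₀ h1]; nlinarith [ht.2]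
      · have h2 : 1 - r ^ 2 ≠ 0 := by nlinarith
        have h3 : 1 + r * ((t - r) / (1 - r * t)) = (1 - r ^ 2) / (1 - r * t) := by
          field_simp [h1.ne']
          ring
        simp only
        rw [h3, div_div_eq_mul_div, div_eq_iff h2, add_mul, div_mul_cancel₀ _ h1.ne']
        ring
  have hderiv : ∀ s ∈ Set.Ioo (-1 : ℝ) 1, HasDerivWithinAt (fun s : ℝ => (s + r) / (1 + r * s))
      ((1 - r ^ 2) / (1 + r * s) ^ 2) (Set.Ioo (-1) 1) s := by
    intro s hs
    have := ((hasDerivAt_id s).add_const r).div (((hasDerivAt_id s).const_mul r).const_add 1)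
      (hpos s hs).ne'
    refine HasDerivAt.hasDerivWithinAt (this.congr_deriv ?_)
    simp only [id]
    ring
  have hinj : Set.InjOn (fun s : ℝ => (s + r) / (1 + r * s)) (Set.Ioo (-1) 1) := by
    intro s hs t ht h
    have h2 : 0 < 1 - r ^ 2 := by nlinarith
    simp only at h
    rw [div_eq_div_iff (hpos s hs).ne' (hpos t ht).ne'] at h
    have : (1 - r ^ 2) * (s - t) = 0 := by linear_combination h
    rcases mul_eq_zero.1 this with h | h <;> linarith
  conv_lhs => rw [← himg]
  rw [integral_image_eq_integral_abs_deriv_smul measurableSet_Ioo hderiv hinj]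
  refine setIntegral_congr_fun measurableSet_Ioo fun s hs => ?_
  have h2 : 0 < 1 - r ^ 2 := by nlinarith
  simp only [smul_eq_mul]
  rw [abs_of_pos (div_pos h2 (pow_pos (hpos s hs) 2))]

theorem one_sub_mobius_sq {r s : ℝ} (h : 1 + r * s ≠ 0) :
    1 - ((s + r) / (1 + r * s)) ^ 2 = (1 - r ^ 2) * (1 - s ^ 2) / (1 + r * s) ^ 2 := by
  rw [div_pow, eq_div_iff (pow_ne_zero 2 h), sub_mul, div_mul_cancel₀ _ (pow_ne_zero 2 h)]
  ring

theorem integral_sub_rpow_mul_one_sub_sq_rpow {a z : ℝ} (hz : 1 < z) :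
    ∫ y in Set.Ioo (-1 : ℝ) 1, (z - y) ^ (a - 2) * (1 - y ^ 2) ^ (-a / 2) =
      (z ^ 2 - 1) ^ (a / 2 - 1) * ∫ y in Set.Ioo (-1 : ℝ) 1, (1 - y ^ 2) ^ (-a / 2) := by
  have hz0 : 0 < z := by linarith
  have hr : z⁻¹ < 1 := inv_lt_one_of_one_lt₀ hz
  have hr0 : 0 < z⁻¹ := inv_pos.2 hz0
  rw [integral_mobius ⟨by linarith, hr⟩, ← integral_const_mul]
  refine setIntegral_congr_fun measurableSet_Ioo fun s hs => ?_
  have hp : 0 < 1 + z⁻¹ * s := by nlinarith [hs.1, hs.2]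
  have hz1 : 0 < z ^ 2 - 1 := by nlinarith
  have hs1 : 0 < 1 - s ^ 2 := by nlinarith [hs.1, hs.2]
  have e1 : z - (s + z⁻¹) / (1 + z⁻¹ * s) = (z ^ 2 - 1) / (z * (1 + z⁻¹ * s)) := by
    rw [eq_div_iff (by positivity), sub_mul, mul_left_comm (_ / _), div_mul_cancel₀ _ hp.ne']
    field_simp
    ring
  have e2 : 1 - z⁻¹ ^ 2 = (z ^ 2 - 1) / z ^ 2 := by field_simp
  rw [e1, one_sub_mobius_sq hp.ne', e2]
  generalize 1 + z⁻¹ * s = w at hp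
  generalize z ^ 2 - 1 = d at hz1
  generalize 1 - s ^ 2 = e at hs1
  rw [div_rpow hz1.le (by positivity), div_rpow (by positivity) (by positivity),
    mul_rpow (by positivity) hs1.le, div_rpow hz1.le (by positivity), mul_rpow hz0.le hp.le]
  have k : ∀ u : ℝ, 0 < u → (u ^ 2) ^ (-a / 2) = u ^ (-a) := fun u hu => by
    rw [← rpow_natCast, ← rpow_mul hu.le]
    ring_nf
  have k2 : ∀ u : ℝ, 0 < u → u ^ (a - 2) = (u ^ (-a))⁻¹ / u ^ 2 := fun u hu => by
    rw [rpow_sub hu, rpow_neg hu.le, inv_inv]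
    norm_num
  have k3 : d ^ (a / 2 - 1) = d ^ (a - 2) * d ^ (-a / 2) * d := by
    rw [← rpow_add hz1, ← rpow_add_one hz1.ne']
    ring_nf
  rw [k w hp, k z hz0, k2 w hp, k2 z hz0, k3]
  have : w ^ (-a) ≠ 0 := (rpow_pos_of_pos hp _).ne'
  have : z ^ (-a) ≠ 0 := (rpow_pos_of_pos hz0 _).ne'
  field_simp

/-- Tonelli's theorem for iterated set integrals of a nonnegative function. -/
theorem setIntegral_setIntegral_swap_of_nonneg {S T : Set ℝ} (hS : MeasurableSet S)
    (hT : MeasurableSet T) {f : ℝ → ℝ → ℝ} (hf : Measurable (Function.uncurry f))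
    (h0 : ∀ y ∈ S, ∀ t ∈ T, 0 ≤ f y t) (h1 : ∀ y ∈ S, IntegrableOn (f y) T)
    (h2 : IntegrableOn (fun y => ∫ t in T, f y t) S) :
    ∫ y in S, ∫ t in T, f y t = ∫ t in T, ∫ y in S, f y t := by
  apply integral_integral_swap
  rw [integrable_prod_iff hf.aestronglyMeasurable]
  refine ⟨ae_restrict_of_forall_mem hS h1, h2.congr_fun (fun y hy => ?_) hS⟩
  exact setIntegral_congr_fun hT fun t ht => (norm_of_nonneg (h0 y hy t ht)).symm

theorem integrableOn_and_integral_Ioi_sub_rpow {b y t : ℝ} (hb : b < -1) (hyt : y < t) :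
    IntegrableOn (fun z : ℝ => (z - y) ^ b) (Set.Ioi t) ∧
      ∫ z in Set.Ioi t, (z - y) ^ b = (t - y) ^ (b + 1) / (-(b + 1)) := by
  have hint := integrableOn_add_rpow_Ioi_of_lt (a := b) (c := t) (m := -y) hb (by linarith)
  simp only [← sub_eq_add_neg] at hint
  refine ⟨hint, ?_⟩
  have hd : ∀ z ∈ Set.Ici t, HasDerivAt (fun z => (z - y) ^ (b + 1) / (b + 1)) ((z - y) ^ b) z := by
    intro z hz
    have hz' : z - y ≠ 0 := by linarith [Set.mem_Ici.1 hz]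
    have := (((hasDerivAt_id z).sub_const y).rpow_const (p := b + 1) (Or.inl hz')).div_const (b + 1)
    refine this.congr_deriv ?_
    have : b + 1 ≠ 0 := by linarith
    simp only [id, add_sub_cancel_right]
    field_simp
  have ht : Filter.Tendsto (fun z => (z - y) ^ (b + 1) / (b + 1)) Filter.atTop
      (nhds (0 / (b + 1))) := by
    rw [← neg_neg (b + 1)]
    exact ((tendsto_rpow_neg_atTop (by linarith)).comp
      (Filter.tendsto_atTop_add_const_right _ (-y) Filter.tendsto_id)).div_const _
  rw [integral_Ioi_of_hasDerivAt_of_tendsto' hd hint ht, zero_div, zero_sub, div_neg]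

theorem integrableOn_sub_rpow_mul {t b c : ℝ} (ht : 1 < t) (hc : -1 < c) :
    IntegrableOn (fun y : ℝ => (t - y) ^ b * (1 - y ^ 2) ^ c) (Set.Ioo (-1) 1) := by
  refine (integrableOn_one_sub_sq_rpow hc).continuousOn_mul_of_subset (K := Set.Icc (-1) 1) ?_
    isCompact_Icc measurableSet_Ioo Set.Ioo_subset_Icc_self
  refine ContinuousOn.rpow_const (by fun_prop) fun y hy => Or.inl ?_
  linarith [hy.2]

theorem integral_sub_rpow_sub_one_mul {a t : ℝ} (ha : a < 1) (ht : 1 < t) :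
    ∫ y in Set.Ioo (-1 : ℝ) 1, (t - y) ^ (a - 1) * (1 - y ^ 2) ^ (-a / 2) =
      (1 - a) * (∫ y in Set.Ioo (-1 : ℝ) 1, (1 - y ^ 2) ^ (-a / 2)) *
        ∫ z in Set.Ioi t, (z ^ 2 - 1) ^ (a / 2 - 1) := by
  have hin : ∀ y ∈ Set.Ioo (-1 : ℝ) 1,
      ∫ z in Set.Ioi t, (z - y) ^ (a - 2) * (1 - y ^ 2) ^ (-a / 2) =
        (1 - a)⁻¹ * ((t - y) ^ (a - 1) * (1 - y ^ 2) ^ (-a / 2)) := by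
    intro y hy
    rw [integral_mul_const,
      (integrableOn_and_integral_Ioi_sub_rpow (by linarith) (by linarith [hy.2])).2]
    ring_nf
  have hswap := setIntegral_setIntegral_swap_of_nonneg (S := Set.Ioo (-1) 1) (T := Set.Ioi t)
    (f := fun y z => (z - y) ^ (a - 2) * (1 - y ^ 2) ^ (-a / 2)) measurableSet_Ioo
    measurableSet_Ioi (by unfold Function.uncurry; fun_prop)
    (fun y hy z hz => mul_nonneg (rpow_nonneg (by linarith [hy.2, Set.mem_Ioi.1 hz]) _)
      (rpow_nonneg (by nlinarith [hy.1, hy.2]) _))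
    (fun y hy => by
      refine Integrable.mul_const ?_ _
      exact (integrableOn_and_integral_Ioi_sub_rpow (by linarith) (by linarith [hy.2])).1)
    (IntegrableOn.congr_fun ((integrableOn_sub_rpow_mul (b := a - 1) (c := -a / 2) ht
      (by linarith)).const_mul (1 - a)⁻¹) (fun y hy => (hin y hy).symm) measurableSet_Ioo)
  rw [setIntegral_congr_fun measurableSet_Ioo hin, integral_const_mul,
    setIntegral_congr_fun measurableSet_Ioi fun z (hz : t < z) =>
      integral_sub_rpow_mul_one_sub_sq_rpow (a := a) (ht.trans hz), integral_mul_const] at hswap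
  rw [inv_mul_eq_iff_eq_mul₀ (by linarith)] at hswap
  rw [hswap]
  ring

theorem integrableOn_and_integral_one_sub_rpow_mul {a : ℝ} (ha : -1 < a) (ha1 : a < 1) :
    IntegrableOn (fun y : ℝ => (1 - y) ^ a * (1 - y ^ 2) ^ (-a / 2)) (Set.Ioo (-1) 1) ∧
      ∫ y in Set.Ioo (-1 : ℝ) 1, (1 - y) ^ a * (1 - y ^ 2) ^ (-a / 2) =
        2 * (Gamma (1 + a / 2) * Gamma (1 - a / 2)) := by
  have h := integrableOn_and_integral_one_sub_rpow_mul_one_add_rpow (p := a / 2) (q := -a / 2)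
    (by linarith) (by linarith)
  have heq : Set.EqOn (fun y : ℝ => (1 - y) ^ (a / 2) * (1 + y) ^ (-a / 2))
      (fun y : ℝ => (1 - y) ^ a * (1 - y ^ 2) ^ (-a / 2)) (Set.Ioo (-1) 1) := by
    intro y hy
    simp only
    rw [one_sub_sq_rpow hy, ← mul_assoc, ← rpow_add (by linarith [hy.2])]
    ring_nf
  refine ⟨h.1.congr_fun heq measurableSet_Ioo, ?_⟩
  rw [← setIntegral_congr_fun measurableSet_Ioo heq, h.2,
    show a / 2 + -a / 2 + 1 = 1 by ring, show a / 2 + -a / 2 + 2 = 2 by ring,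
    show a / 2 + 1 = 1 + a / 2 by ring, show -a / 2 + 1 = 1 - a / 2 by ring, Gamma_two, rpow_one,
    div_one]

theorem integral_sub_rpow_mul_of_one_lt {a x : ℝ} (ha : -1 < a) (ha1 : a < 1) (ha0 : a ≠ 0)
    (hx : 1 < x) :
    ∫ y in Set.Ioo (-1 : ℝ) 1, (x - y) ^ a * (1 - y ^ 2) ^ (-a / 2) =
      2 * (Gamma (1 + a / 2) * Gamma (1 - a / 2)) +
        a * (1 - a) * (∫ y in Set.Ioo (-1 : ℝ) 1, (1 - y ^ 2) ^ (-a / 2)) *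
          ∫ t in (1 : ℝ)..x, ∫ z in Set.Ioi t, (z ^ 2 - 1) ^ (a / 2 - 1) := by
  obtain ⟨h1, h1v⟩ := integrableOn_and_integral_one_sub_rpow_mul ha ha1
  have hxi := integrableOn_sub_rpow_mul (b := a) (c := -a / 2) hx (by linarith)
  have hin : ∀ y ∈ Set.Ioo (-1 : ℝ) 1,
      ∫ t in Set.Ioc 1 x, (t - y) ^ (a - 1) * (1 - y ^ 2) ^ (-a / 2) =
        a⁻¹ * ((x - y) ^ a * (1 - y ^ 2) ^ (-a / 2) - (1 - y) ^ a * (1 - y ^ 2) ^ (-a / 2)) := by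
    intro y hy
    rw [integral_mul_const, ← intervalIntegral.integral_of_le hx.le,
      intervalIntegral.integral_comp_sub_right (fun u => u ^ (a - 1)), integral_rpow]
    · ring_nf
    · right
      refine ⟨fun h => ha0 (by linarith), ?_⟩
      rw [Set.uIcc_of_le (by linarith)]
      intro h
      linarith [h.1, hy.2]
  have hswap := setIntegral_setIntegral_swap_of_nonneg (S := Set.Ioo (-1) 1) (T := Set.Ioc 1 x)
    (f := fun y t => (t - y) ^ (a - 1) * (1 - y ^ 2) ^ (-a / 2)) measurableSet_Ioo
    measurableSet_Ioc (by unfold Function.uncurry; fun_prop)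
    (fun y hy z hz => mul_nonneg (rpow_nonneg (by linarith [hy.2, hz.1]) _)
      (rpow_nonneg (by nlinarith [hy.1, hy.2]) _))
    (fun y hy => by
      refine Integrable.mul_const ?_ _
      refine IntegrableOn.mono_set (ContinuousOn.integrableOn_Icc ?_) Set.Ioc_subset_Icc_self
      exact ContinuousOn.rpow_const (by fun_prop) fun t ht => Or.inl (by linarith [ht.1, hy.2]))
    (IntegrableOn.congr_fun ((hxi.sub h1).const_mul a⁻¹) (fun y hy => (hin y hy).symm)
      measurableSet_Ioo)
  rw [setIntegral_congr_fun measurableSet_Ioo hin, integral_const_mul, integral_sub hxi h1, h1v,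
    setIntegral_congr_fun measurableSet_Ioc fun t ht =>
      integral_sub_rpow_sub_one_mul ha1 ht.1, integral_const_mul,
    inv_mul_eq_iff_eq_mul₀ ha0, ← intervalIntegral.integral_of_le hx.le] at hswap
  linear_combination hswap

theorem integral_eq_integral_add_comp_neg {h : ℝ → ℝ} (h1 : IntegrableOn h (Set.Ioo 0 1))
    (h2 : IntegrableOn (fun s => h (-s)) (Set.Ioo 0 1)) :
    ∫ s in Set.Ioo (-1 : ℝ) 1, h s = ∫ s in Set.Ioo (0 : ℝ) 1, (h s + h (-s)) := by
  have i1 := (intervalIntegrable_iff_integrableOn_Ioo_of_le (zero_le_one' ℝ)).2 h1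
  have i2 := (intervalIntegrable_iff_integrableOn_Ioo_of_le (zero_le_one' ℝ)).2 h2
  have i3 : IntervalIntegrable h volume (-1) 0 := by
    have := i2.comp_sub_left 0
    simpa using this.symm
  rw [integral_add h1 h2]
  simp only [← integral_Ioc_eq_integral_Ioo]
  rw [← intervalIntegral.integral_of_le (by norm_num), ← intervalIntegral.integral_of_le
    zero_le_one, ← intervalIntegral.integral_of_le zero_le_one, intervalIntegral.integral_comp_neg,
    ← intervalIntegral.integral_add_adjacent_intervals i3 i1, neg_zero]
  ring

/-- The Beta integral `B(1 + a / 2, 1 - a / 2)` after the change of variables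
`s ↦ s² (1 - x²) / (1 - x² s²)`. -/
theorem integral_rpow_mul_one_sub_sq_rpow_div {a x : ℝ} (ha : -1 < a) (ha1 : a < 1)
    (hx : x ^ 2 < 1) :
    (1 - x ^ 2) ^ (1 + a / 2) * ∫ s in Set.Ioo (0 : ℝ) 1,
        s ^ a * (1 - s ^ 2) ^ (-a / 2) * (2 * s / (1 - x ^ 2 * s ^ 2) ^ 2) =
      Gamma (1 + a / 2) * Gamma (1 - a / 2) := by
  obtain ⟨-, hval⟩ := integrableOn_and_integral_rpow_mul_one_sub_rpow (p := a / 2) (q := -a / 2)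
    (by linarith) (by linarith)
  have hk : 0 < 1 - x ^ 2 := by linarith
  have hpos : ∀ s ∈ Set.Ioo (0 : ℝ) 1, 0 < 1 - x ^ 2 * s ^ 2 := fun s hs => by
    have : s ^ 2 < 1 := by nlinarith [hs.1, hs.2]
    nlinarith [sq_nonneg x, sq_nonneg s]
  have hsub : ∀ s ∈ Set.Ioo (0 : ℝ) 1,
      1 - s ^ 2 * (1 - x ^ 2) / (1 - x ^ 2 * s ^ 2) = (1 - s ^ 2) / (1 - x ^ 2 * s ^ 2) :=
    fun s hs => by
      rw [eq_div_iff (hpos s hs).ne', sub_mul, div_mul_cancel₀ _ (hpos s hs).ne']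
      ring
  have himg : (fun s : ℝ => s ^ 2 * (1 - x ^ 2) / (1 - x ^ 2 * s ^ 2)) '' Set.Ioo 0 1 =
      Set.Ioo 0 1 := by
    ext v
    constructor
    · rintro ⟨s, hs, rfl⟩
      have hs2 : 0 < 1 - s ^ 2 := by nlinarith [hs.1, hs.2]
      refine ⟨div_pos (mul_pos (pow_pos hs.1 2) hk) (hpos s hs), ?_⟩
      have := hsub s hs ▸ div_pos hs2 (hpos s hs)
      simp only
      linarith
    · intro hv
      have hd : 0 < 1 - x ^ 2 + x ^ 2 * v := by nlinarith [hv.1, sq_nonneg x]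
      refine ⟨√(v / (1 - x ^ 2 + x ^ 2 * v)), ⟨sqrt_pos.2 (div_pos hv.1 hd), ?_⟩, ?_⟩
      · rw [sqrt_lt' one_pos, one_pow, div_lt_one hd]
        nlinarith [hv.1, hv.2]
      · simp only
        rw [sq_sqrt (div_pos hv.1 hd).le]
        have : 1 - x ^ 2 * (v / (1 - x ^ 2 + x ^ 2 * v)) =
            (1 - x ^ 2) / (1 - x ^ 2 + x ^ 2 * v) := by
          rw [eq_div_iff hd.ne', sub_mul, mul_assoc, div_mul_cancel₀ _ hd.ne']
          ring
        rw [this, div_mul_eq_mul_div, div_div_div_cancel_right₀ hd.ne',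
          mul_div_cancel_right₀ _ hk.ne']
  have hderiv : ∀ s ∈ Set.Ioo (0 : ℝ) 1,
      HasDerivWithinAt (fun s : ℝ => s ^ 2 * (1 - x ^ 2) / (1 - x ^ 2 * s ^ 2))
        ((1 - x ^ 2) * (2 * s / (1 - x ^ 2 * s ^ 2) ^ 2)) (Set.Ioo 0 1) s := by
    intro s hs
    have := ((hasDerivAt_pow 2 s).mul_const (1 - x ^ 2)).div
      (((hasDerivAt_pow 2 s).const_mul (x ^ 2)).const_sub 1) (hpos s hs).ne'
    refine HasDerivAt.hasDerivWithinAt (this.congr_deriv ?_)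
    rw [mul_div_assoc']
    congr 1
    push_cast
    ring
  have hinj : Set.InjOn (fun s : ℝ => s ^ 2 * (1 - x ^ 2) / (1 - x ^ 2 * s ^ 2)) (Set.Ioo 0 1) := by
    intro s hs t ht h
    simp only at h
    rw [div_eq_div_iff (hpos s hs).ne' (hpos t ht).ne'] at h
    have h2 : (1 - x ^ 2) * (s ^ 2 - t ^ 2) = 0 := by linear_combination h
    rcases mul_eq_zero.1 h2 with h | h
    · linarith
    · exact (pow_left_inj₀ hs.1.le ht.1.le two_ne_zero).1 (by linarith)
  rw [← himg, integral_image_eq_integral_abs_deriv_smul measurableSet_Ioo hderiv hinj] at hval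
  rw [show -a / 2 + 1 = 1 - a / 2 by ring, show a / 2 + 1 = 1 + a / 2 by ring,
    show a / 2 + -a / 2 + 2 = 2 by ring, Gamma_two, div_one] at hval
  rw [← hval, ← integral_const_mul]
  refine setIntegral_congr_fun measurableSet_Ioo fun s hs => ?_
  have hp := hpos s hs
  have hs0 := hs.1
  have hs2 : 0 < 1 - s ^ 2 := by nlinarith [hs.1, hs.2]
  have hpow : (s ^ 2) ^ (a / 2) = s ^ a := by
    rw [← rpow_natCast, ← rpow_mul hs0.le]
    ring_nf
  simp only [smul_eq_mul]
  rw [hsub s hs, abs_of_pos (by positivity), div_rpow (by positivity) hp.le, div_rpow hs2.le hp.le,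
    mul_rpow (by positivity) hk.le, rpow_add hk, rpow_one, neg_div, rpow_neg hp.le, hpow]
  have : (1 - x ^ 2 * s ^ 2) ^ (a / 2) ≠ 0 := (rpow_pos_of_pos hp _).ne'
  field_simp

theorem integral_sign_mul_of_abs_lt_one {a x : ℝ} (ha : -1 < a) (ha1 : a < 1) (hx : |x| < 1) :
    ∫ y in Set.Ioo (-1 : ℝ) 1, sign (x - y) * |x - y| ^ a * (1 - y ^ 2) ^ (-a / 2) =
      2 * (Gamma (1 + a / 2) * Gamma (1 - a / 2)) * x := by
  have hx' := abs_lt.1 hx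
  have hx2 : x ^ 2 < 1 := by nlinarith
  have hk : 0 < 1 - x ^ 2 := by linarith
  have hbase : IntegrableOn (fun s : ℝ => s ^ a * (1 - s ^ 2) ^ (-a / 2)) (Set.Ioo 0 1) := by
    have h := (integrableOn_and_integral_rpow_mul_one_sub_rpow (p := a) (q := -a / 2) ha
      (by linarith)).1
    refine (h.mul_continuousOn_of_subset (K := Set.Icc 0 1) (g' := fun s => (1 + s) ^ (-a / 2)) ?_
      measurableSet_Ioo isCompact_Icc Set.Ioo_subset_Icc_self).congr_fun ?_ measurableSet_Ioo
    · exact ContinuousOn.rpow_const (by fun_prop) fun s hs => Or.inl (by linarith [hs.1])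
    · intro s hs
      simp only
      rw [one_sub_sq_rpow ⟨by linarith [hs.1], hs.2⟩, mul_assoc]
  have hG : ∀ r : ℝ, |r| < 1 → IntegrableOn
      (fun s : ℝ => s ^ a * (1 - s ^ 2) ^ (-a / 2) * ((1 + r * s) ^ 2)⁻¹) (Set.Ioo 0 1) := by
    intro r hr
    refine hbase.mul_continuousOn_of_subset (K := Set.Icc 0 1) ?_
      measurableSet_Ioo isCompact_Icc Set.Ioo_subset_Icc_self
    refine ContinuousOn.inv₀ (by fun_prop) fun s hs => pow_ne_zero 2 ?_
    nlinarith [mul_nonneg (neg_le_iff_add_nonneg.1 (neg_abs_le r)) hs.1,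
      mul_nonneg (abs_nonneg r) (sub_nonneg.2 hs.2)]
  set c := (1 - x ^ 2) ^ (1 + a / 2) with hc
  have hmob : ∀ s ∈ Set.Ioo (-1 : ℝ) 1, (1 - x ^ 2) / (1 + x * s) ^ 2 *
      (sign (x - (s + x) / (1 + x * s)) * |x - (s + x) / (1 + x * s)| ^ a *
        (1 - ((s + x) / (1 + x * s)) ^ 2) ^ (-a / 2)) =
      -c * (sign s * |s| ^ a * (1 - s ^ 2) ^ (-a / 2) * ((1 + x * s) ^ 2)⁻¹) := by
    intro s hs
    have hp : 0 < 1 + x * s := by nlinarith [hs.1, hs.2]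
    have hs2 : 0 < 1 - s ^ 2 := by nlinarith [hs.1, hs.2]
    have e1 : x - (s + x) / (1 + x * s) = -(s * ((1 - x ^ 2) / (1 + x * s))) := by
      rw [mul_div_assoc', eq_comm, neg_eq_iff_eq_neg, div_eq_iff hp.ne', neg_sub, sub_mul,
        div_mul_cancel₀ _ hp.ne']
      ring
    have e2 : sign (-(s * ((1 - x ^ 2) / (1 + x * s)))) = -sign s := by
      have hq : 0 < (1 - x ^ 2) / (1 + x * s) := div_pos hk hp
      rcases lt_trichotomy s 0 with h | h | h
      · rw [sign_of_neg h, sign_of_pos (by nlinarith), neg_neg]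
      · simp [h]
      · rw [sign_of_pos h, sign_of_neg (by nlinarith)]
    rw [e1, e2, abs_neg, abs_mul, abs_of_pos (div_pos hk hp), one_sub_mobius_sq hp.ne',
      mul_rpow (abs_nonneg s) (div_pos hk hp).le, div_rpow hk.le hp.le,
      div_rpow (by positivity) (by positivity), mul_rpow hk.le hs2.le, ← rpow_natCast (1 + x * s) 2,
      ← rpow_mul hp.le, show ((2 : ℕ) : ℝ) * (-a / 2) = -a by push_cast; ring, rpow_neg hp.le,
      hc, show 1 + a / 2 = 1 + a + -a / 2 by ring, rpow_add hk, rpow_add hk, rpow_one, rpow_natCast]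
    have : (1 + x * s) ^ a ≠ 0 := (rpow_pos_of_pos hp _).ne'
    field_simp
  rw [integral_mobius ⟨hx'.1, hx'.2⟩, setIntegral_congr_fun measurableSet_Ioo hmob,
    integral_const_mul, integral_eq_integral_add_comp_neg]
  · have hsum : ∀ s ∈ Set.Ioo (0 : ℝ) 1,
        sign s * |s| ^ a * (1 - s ^ 2) ^ (-a / 2) * ((1 + x * s) ^ 2)⁻¹ +
          sign (-s) * |(-s)| ^ a * (1 - (-s) ^ 2) ^ (-a / 2) * ((1 + x * -s) ^ 2)⁻¹ =
        -(2 * x) * (s ^ a * (1 - s ^ 2) ^ (-a / 2) * (2 * s / (1 - x ^ 2 * s ^ 2) ^ 2)) := by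
      intro s hs
      have h1 : 1 + x * s ≠ 0 := by nlinarith [hs.1, hs.2]
      have h2 : 1 - x * s ≠ 0 := by nlinarith [hs.1, hs.2]
      rw [sign_of_pos hs.1, sign_of_neg (neg_neg_of_pos hs.1), abs_neg, abs_of_pos hs.1, neg_sq,
        show 1 - x ^ 2 * s ^ 2 = (1 + x * s) * (1 - x * s) by ring, mul_neg, ← sub_eq_add_neg]
      have h3 : ((1 + x * s) ^ 2)⁻¹ - ((1 - x * s) ^ 2)⁻¹ =
          -(2 * x) * (2 * s / ((1 + x * s) * (1 - x * s)) ^ 2) := by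
        rw [mul_pow]
        field_simp
        ring
      linear_combination (s ^ a * (1 - s ^ 2) ^ (-a / 2)) * h3
    rw [setIntegral_congr_fun measurableSet_Ioo hsum, integral_const_mul,
      ← integral_rpow_mul_one_sub_sq_rpow_div ha ha1 hx2, ← hc]
    ring
  · refine (hG x hx).congr_fun (fun s hs => ?_) measurableSet_Ioo
    simp only
    rw [sign_of_pos hs.1, abs_of_pos hs.1, one_mul]
  · refine (hG (-x) (by rwa [abs_neg])).neg.congr_fun (fun s hs => ?_) measurableSet_Ioo
    simp only [Pi.neg_apply]
    rw [sign_of_neg (neg_neg_of_pos hs.1), abs_neg, abs_of_pos hs.1, neg_sq]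
    ring

theorem integral_sign_mul_neg (a b x : ℝ) :
    ∫ y in (-1 : ℝ)..1, sign (-x - y) * |-x - y| ^ a * (1 - y ^ 2) ^ b =
      -∫ y in (-1 : ℝ)..1, sign (x - y) * |x - y| ^ a * (1 - y ^ 2) ^ b := by
  rw [← intervalIntegral.integral_neg]
  have h := intervalIntegral.integral_comp_neg (a := -1) (b := 1)
    fun y : ℝ => sign (-x - y) * |-x - y| ^ a * (1 - y ^ 2) ^ b
  rw [neg_neg] at h
  rw [← h]
  refine intervalIntegral.integral_congr fun y _ => ?_
  rw [show -x - -y = -(x - y) by ring, sign_neg, abs_neg, neg_sq]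
  ring

/-- equation (3.3). For `0 < α < 2`, `α ≠ 1`, and `x ∈ ℝ` with `|x| ≠ 1`,
`∫_{-1}^{1} sgn(x-y) |x-y|^{α-1} (1-y²)^{-(α-1)/2} dy` equals `(α-1) c_α x` if `|x| < 1` and
equals
`(α-1) c_α x + (α-1) c_α⁽¹⁾ sgn(x)(|x|-1) - (α-1)(α-2) C_α sgn(x) ∫_1^{|x|} ∫_y^∞ (z²-1)^{-(3-α)/2} dz dy`
if `|x| > 1`, where `c_α⁽¹⁾ = -C_α Γ((α-1)/2) Γ((4-α)/2)/√π`, so that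
`(α-1) c_α⁽¹⁾ = -2 C_α Γ((α+1)/2) Γ((4-α)/2)/√π`. -/
theorem integral_sign_abs_rpow_sub_one_zero_lt_alpha_lt_two
    (α : ℝ) (hα0 : 0 < α) (hα2 : α < 2) (hα1 : α ≠ 1)
    (Cα cα cα1 : ℝ)
    (hC : Cα = Real.sqrt π * Real.Gamma ((3 - α) / 2) / Real.Gamma ((4 - α) / 2))
    (hc : cα = π / Real.sin ((α - 1) * π / 2))
    (hc1 : cα1 = -Cα * (Real.Gamma ((α - 1) / 2) * Real.Gamma ((4 - α) / 2) / Real.sqrt π)) :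
    (α - 1) * cα1 =
      -2 * Cα * (Real.Gamma ((α + 1) / 2) * Real.Gamma ((4 - α) / 2) / Real.sqrt π) ∧
    ∀ x : ℝ, |x| ≠ 1 →
      (∫ y in (-1 : ℝ)..1,
          Real.sign (x - y) * |x - y| ^ (α - 1) * (1 - y ^ 2) ^ (-(α - 1) / 2)) =
        if |x| < 1 then (α - 1) * cα * x
        else (α - 1) * cα * x + (α - 1) * cα1 * Real.sign x * (|x| - 1) -
          (α - 1) * (α - 2) * Cα * Real.sign x *
            ∫ y in (1 : ℝ)..|x|, ∫ z in Set.Ioi y, (z ^ 2 - 1) ^ (-(3 - α) / 2) := by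
  have hΓ : Gamma (1 + (α - 1) / 2) = (α - 1) / 2 * Gamma ((α - 1) / 2) := by
    rw [add_comm, Gamma_add_one (div_ne_zero (sub_ne_zero.2 hα1) two_ne_zero)]
  have hrefl : Gamma ((α - 1) / 2) * Gamma (1 - (α - 1) / 2) = cα := by
    rw [Gamma_mul_Gamma_one_sub, hc]
    ring_nf
  have hCw : Cα = ∫ y in Set.Ioo (-1 : ℝ) 1, (1 - y ^ 2) ^ (-(α - 1) / 2) := by
    rw [integral_one_sub_sq_rpow (by linarith), hC]
    ring_nf
  have hcα : 2 * (Gamma (1 + (α - 1) / 2) * Gamma (1 - (α - 1) / 2)) = (α - 1) * cα := by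
    rw [hΓ, ← hrefl]
    ring
  have hc1' : cα1 = -cα := by
    have h1 : Gamma ((4 - α) / 2) ≠ 0 := (Gamma_pos_of_pos (by linarith)).ne'
    have h2 : √π ≠ 0 := (sqrt_pos.2 pi_pos).ne'
    rw [hc1, hC, ← hrefl, show 1 - (α - 1) / 2 = (3 - α) / 2 by ring]
    field_simp
  refine ⟨?_, ?_⟩
  · rw [hc1, show (α + 1) / 2 = 1 + (α - 1) / 2 by ring, hΓ]
    ring
  have hset : ∀ x : ℝ, ∫ y in (-1 : ℝ)..1,
      sign (x - y) * |x - y| ^ (α - 1) * (1 - y ^ 2) ^ (-(α - 1) / 2) =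
      ∫ y in Set.Ioo (-1 : ℝ) 1,
        sign (x - y) * |x - y| ^ (α - 1) * (1 - y ^ 2) ^ (-(α - 1) / 2) := fun x => by
    rw [intervalIntegral.integral_of_le (by norm_num), integral_Ioc_eq_integral_Ioo]
  have hout : ∀ x : ℝ, 1 < x → ∫ y in (-1 : ℝ)..1,
      sign (x - y) * |x - y| ^ (α - 1) * (1 - y ^ 2) ^ (-(α - 1) / 2) =
      (α - 1) * cα - (α - 1) * (α - 2) * Cα *
        ∫ y in (1 : ℝ)..x, ∫ z in Set.Ioi y, (z ^ 2 - 1) ^ (-(3 - α) / 2) := by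
    intro x hx
    have heq : Set.EqOn (fun y : ℝ =>
        sign (x - y) * |x - y| ^ (α - 1) * (1 - y ^ 2) ^ (-(α - 1) / 2))
        (fun y => (x - y) ^ (α - 1) * (1 - y ^ 2) ^ (-(α - 1) / 2)) (Set.Ioo (-1) 1) := by
      intro y hy
      have h : 0 < x - y := by linarith [hy.2]
      simp only
      rw [sign_of_pos h, abs_of_pos h, one_mul]
    rw [hset, setIntegral_congr_fun measurableSet_Ioo heq,
      integral_sub_rpow_mul_of_one_lt (by linarith) (by linarith) (sub_ne_zero.2 hα1) hx, hcα,
      ← hCw, show (α - 1) / 2 - 1 = -(3 - α) / 2 by ring]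
    ring
  intro x hx
  split_ifs with h
  · rw [hset, integral_sign_mul_of_abs_lt_one (by linarith) (by linarith) h, hcα]
  · have h1 : 1 < |x| := lt_of_le_of_ne (not_lt.1 h) hx.symm
    rcases lt_abs.1 h1 with h2 | h2
    · rw [hout x h2, abs_of_pos (by linarith), sign_of_pos (by linarith), hc1']
      ring
    · have := integral_sign_mul_neg (α - 1) (-(α - 1) / 2) (-x)
      rw [neg_neg] at this
      rw [this, hout _ h2, abs_of_neg (by linarith), sign_of_neg (by linarith), hc1']
      ring
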